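/- arXiv:2411.10763 — 2 statements merged into one kernel-verified Lean document; each statement's English description precedes it below -/
import Mathlib

section
/- Set d₁ = dim_K(W ∩ E₁) and d₂ = dim_K(W ∩ E₂). Then the set {k ∈ {0,…,p} : P_I(W) ≠ 0 for some type-k subset I} is exactly the integer interval {d₂, d₂+1, …, p − d₁}. In particular this set is a nonempty interval of length p − d₁ − d₂, the types below d₂ and above p − d₁ all vanish identically, and there exist nonvanishing Plücker coordinates of type d₂ and of type p − d₁. -/
/-- The coordinate subspace of `Kⁿ` consisting of the vectors supported on the set of
coordinates satisfying `P`. -/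
def coordSub (K : Type*) [Field K] (n : ℕ) (P : Fin n → Prop) : Submodule K (Fin n → K) where
  carrier := {x | ∀ i, ¬ P i → x i = 0}
  add_mem' := by
    intro a b ha hb i hi
    simp [ha i hi, hb i hi]
  zero_mem' := by intro i _; rfl
  smul_mem' := by
    intro c x hx i hi
    simp [hx i hi]

/-- A linearly independent subfamily has as many members as the dimension of its span. -/
lemma LinearIndepOn.ncard_eq_finrank_span {K V ι : Type*} [Field K] [AddCommGroup V] [Module K V]
    [Finite ι] {v : ι → V} {t : Set ι} (ht : LinearIndepOn K v t) :
    t.ncard = Module.finrank K (Submodule.span K (v '' t)) := by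
  have := Fintype.ofFinite t
  have h := finrank_span_eq_card ht
  rw [← Nat.card_coe_set_eq, Nat.card_eq_fintype_card, ← h, Set.range_comp', Subtype.range_coe]

/-- Among the bases contained in a finite spanning family, the possible numbers of members
lying in `B` form the interval from `dim V - rank Bᶜ` to `rank B`. -/
lemma exists_linearIndepOn_ncard_inter_iff {K V ι : Type*} [Field K] [AddCommGroup V] [Module K V]
    [FiniteDimensional K V] [Finite ι] {v : ι → V} (hv : Submodule.span K (Set.range v) = ⊤)
    (B : Set ι) (k : ℕ) :
    (∃ I : Set ι, LinearIndepOn K v I ∧ I.ncard = Module.finrank K V ∧ (I ∩ B).ncard = k) ↔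
      Module.finrank K V ≤ k + Module.finrank K (Submodule.span K (v '' Bᶜ)) ∧
        k ≤ Module.finrank K (Submodule.span K (v '' B)) := by
  constructor
  · rintro ⟨I, hI, hcard, rfl⟩
    have key (C : Set ι) : (I ∩ C).ncard ≤ Module.finrank K (Submodule.span K (v '' C)) := by
      rw [(hI.mono Set.inter_subset_left).ncard_eq_finrank_span]
      exact Submodule.finrank_mono
        (Submodule.span_mono (Set.image_mono Set.inter_subset_right))
    refine ⟨?_, key B⟩
    have h := Set.ncard_inter_add_ncard_sdiff_eq_ncard I B
    rw [Set.sdiff_eq] at h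
    have := key Bᶜ
    omega
  · rintro ⟨h₁, h₂⟩
    have span_eq {t u : Set ι} (hut : u ⊆ t) (h : v '' t ⊆ Submodule.span K (v '' u)) :
        Submodule.span K (v '' u) = Submodule.span K (v '' t) :=
      le_antisymm (Submodule.span_mono (Set.image_mono hut)) (Submodule.span_le.2 h)
    obtain ⟨A, hAB, -, hA, hAi⟩ :=
      exists_linearIndepOn_extension (linearIndepOn_empty K v) (Set.empty_subset Bᶜ)
    obtain ⟨C, -, hAC, hC, hCi⟩ := exists_linearIndepOn_extension hAi (Set.subset_univ A)
    rw [Set.image_univ] at hC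
    have hCtop : Submodule.span K (v '' C) = ⊤ := by
      rw [eq_top_iff, ← hv]
      exact Submodule.span_le.2 hC
    have hCA : C ∩ Bᶜ = A := by
      symm
      refine Set.eq_of_subset_of_ncard_le (Set.subset_inter hAC hAB) ?_
      rw [hAi.ncard_eq_finrank_span, (hCi.mono Set.inter_subset_left).ncard_eq_finrank_span,
        span_eq hAB hA]
      exact Submodule.finrank_mono
        (Submodule.span_mono (Set.image_mono Set.inter_subset_right))
    have hCcard : C.ncard = Module.finrank K V := by
      rw [hCi.ncard_eq_finrank_span, hCtop, finrank_top]
    have hAcard := hAi.ncard_eq_finrank_span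
    rw [span_eq hAB hA] at hAcard
    have hsum := Set.ncard_inter_add_ncard_sdiff_eq_ncard C B
    rw [Set.sdiff_eq, hCA] at hsum
    obtain ⟨D, hDB, hCD, hD, hDi⟩ :=
      exists_linearIndepOn_extension (hCi.mono Set.inter_subset_left)
        (Set.inter_subset_right : C ∩ B ⊆ B)
    have hDcard := hDi.ncard_eq_finrank_span
    rw [span_eq hDB hD] at hDcard
    obtain ⟨T, hCT, hTD, hT⟩ := Set.exists_subsuperset_card_eq (n := k) hCD
      (by omega) (by omega)
    obtain ⟨I, hIT, hTI, hI, hIi⟩ :=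
      exists_linearIndepOn_extension (hDi.mono hTD) (Set.subset_union_left : T ⊆ T ∪ A)
    refine ⟨I, hIi, ?_, ?_⟩
    · rw [hIi.ncard_eq_finrank_span, span_eq hIT hI]
      have : Submodule.span K (v '' (T ∪ A)) = ⊤ := by
        rw [eq_top_iff, ← hCtop]
        refine Submodule.span_mono (Set.image_mono fun i hi => ?_)
        by_cases hiB : i ∈ B
        · exact Or.inl (hCT ⟨hi, hiB⟩)
        · exact Or.inr (hCA ▸ ⟨hi, hiB⟩)
      rw [this, finrank_top]
    · rw [← hT]
      congr 1
      ext i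
      constructor
      · rintro ⟨hi, hiB⟩
        exact (hIT hi).resolve_right fun h => hAB h hiB
      · exact fun hi => ⟨hTI hi, hDB (hTD hi)⟩

/-- The intersection of the row space with a coordinate subspace has dimension complementary
to the rank of the columns outside that coordinate subspace. -/
lemma finrank_span_row_inf_coordSub_add {K : Type*} [Field K] {n p : ℕ}
    {M : Matrix (Fin p) (Fin n) K} (hM : LinearIndependent K M.row) (P : Fin n → Prop) :
    Module.finrank K ↥(Submodule.span K (Set.range M.row) ⊓ coordSub K n P) +
      Module.finrank K (Submodule.span K (M.col '' {i | ¬ P i})) = p := by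
  classical
  let N : Matrix (Fin p) {i // ¬ P i} K := M.submatrix id Subtype.val
  have hinj : Function.Injective M.vecMulLinear := Matrix.vecMul_injective_iff.2 hM
  have hmap : Submodule.span K (Set.range M.row) ⊓ coordSub K n P =
      (LinearMap.ker N.vecMulLinear).map M.vecMulLinear := by
    rw [← range_vecMulLinear]
    ext x
    constructor
    · rintro ⟨⟨y, rfl⟩, hy⟩
      exact ⟨y, funext fun i => hy i.1 i.2, rfl⟩
    · rintro ⟨y, hy, rfl⟩
      exact ⟨⟨y, rfl⟩, fun i hi => congrFun hy ⟨i, hi⟩⟩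
  have hcol : Module.finrank K (Submodule.span K (M.col '' {i | ¬ P i})) =
      Module.finrank K (LinearMap.range N.vecMulLinear) := by
    have himage : M.col '' {i | ¬ P i} = Set.range N.col := by
      ext x
      constructor
      · rintro ⟨i, hi, rfl⟩
        exact ⟨⟨i, hi⟩, rfl⟩
      · rintro ⟨i, rfl⟩
        exact ⟨i.1, i.2, rfl⟩
    rw [range_vecMulLinear, ← Matrix.rank_eq_finrank_span_row,
      Matrix.rank_eq_finrank_span_cols, himage]
  rw [hmap, ← (Submodule.equivMapOfInjective _ hinj _).finrank_eq, hcol, add_comm,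
    LinearMap.finrank_range_add_finrank_ker, Module.finrank_fin_fun]

/-- A maximal minor is nonzero exactly when the selected columns are linearly independent. -/
lemma det_submatrix_orderIsoOfFin_ne_zero_iff {K : Type*} [Field K] {n p : ℕ}
    (M : Matrix (Fin p) (Fin n) K) (I : Finset (Fin n)) (hI : I.card = p) :
    (M.submatrix id fun t : Fin p => (I.orderIsoOfFin hI t).1).det ≠ 0 ↔
      LinearIndepOn K M.col (I : Set (Fin n)) := by
  rw [← isUnit_iff_ne_zero, ← Matrix.isUnit_iff_isUnit_det,
    ← Matrix.linearIndependent_cols_iff_isUnit]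
  exact linearIndependent_equiv (I.orderIsoOfFin hI).toEquiv
    (f := fun i : (I : Set (Fin n)) => M.col i)

/-- With `E₁ = span(e₁,…,e_s)`, `E₂ = span(e_{s+1},…,e_n)` the coordinate
subspaces of `Kⁿ`, `W` a `p`-dimensional subspace with basis the rows of `M`,
`d₁ = dim(W ∩ E₁)` and `d₂ = dim(W ∩ E₂)`, the set of types `k` for which some type-`k`
Plücker coordinate of `W` is nonzero is exactly the (nonempty) integer interval
`{d₂, d₂+1, …, p − d₁}`. -/
theorem plucker_support_is_interval
    (K : Type*) [Field K] (n s p : ℕ) (hp : 0 < p) (hpn : p < n) (hs : 0 < s) (hsn : s < n)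
    (W : Submodule K (Fin n → K)) (M : Matrix (Fin p) (Fin n) K)
    (hind : LinearIndependent K (fun i : Fin p => M i))
    (hspan : Submodule.span K (Set.range fun i : Fin p => M i) = W)
    (d₁ d₂ : ℕ)
    (hd₁ : d₁ = Module.finrank K ↥(W ⊓ coordSub K n fun i => i.1 < s))
    (hd₂ : d₂ = Module.finrank K ↥(W ⊓ coordSub K n fun i => s ≤ i.1)) :
    d₂ ≤ p - d₁ ∧
    ∀ k : ℕ,
      (∃ (I : Finset (Fin n)) (hI : I.card = p),
          (I.filter fun i => s ≤ i.1).card = k ∧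
          (M.submatrix id fun t : Fin p => (I.orderIsoOfFin hI t).1).det ≠ 0) ↔
        (d₂ ≤ k ∧ k ≤ p - d₁) := by

  subst hspan
  have h₁ := finrank_span_row_inf_coordSub_add hind fun i => i.1 < s
  have h₂ := finrank_span_row_inf_coordSub_add hind fun i => s ≤ i.1
  change _ = Module.finrank K ↥(Submodule.span K (Set.range M.row) ⊓ _) at hd₁ hd₂
  rw [← hd₁] at h₁
  rw [← hd₂] at h₂
  have htop : Submodule.span K (Set.range M.col) = ⊤ := by
    apply Submodule.eq_top_of_finrank_eq
    rw [← Matrix.rank_eq_finrank_span_cols, Matrix.rank_eq_finrank_span_row,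
      finrank_span_eq_card (b := M.row) hind, Module.finrank_fin_fun, Fintype.card_fin]
  have hB : {i : Fin n | ¬ i.1 < s} = {i | s ≤ i.1} := by ext i; simp
  have hBc : {i : Fin n | ¬ s ≤ i.1} = {i | s ≤ i.1}ᶜ := rfl
  rw [hB] at h₁
  rw [hBc] at h₂
  have key (k : ℕ) := exists_linearIndepOn_ncard_inter_iff htop {i : Fin n | s ≤ i.1} k
  simp only [Module.finrank_fin_fun] at key
  have hsup : p ≤ Module.finrank K (Submodule.span K (M.col '' {i : Fin n | s ≤ i.1})) +
      Module.finrank K (Submodule.span K (M.col '' {i : Fin n | s ≤ i.1}ᶜ)) := by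
    refine le_trans (le_of_eq ?_) (Submodule.finrank_add_le_finrank_add_finrank _ _)
    rw [← Submodule.span_union, ← Set.image_union, Set.union_compl_self, Set.image_univ, htop,
      finrank_top, Module.finrank_fin_fun]
  refine ⟨by omega, fun k => ?_⟩
  have hk : (d₂ ≤ k ∧ k ≤ p - d₁) ↔ _ := Iff.trans (by omega) (key k).symm
  rw [hk]
  have hcard (I : Finset (Fin n)) :
      ((I : Set (Fin n)) ∩ {i | s ≤ i.1}).ncard = (I.filter fun i => s ≤ i.1).card := by
    rw [← Set.ncard_coe_finset, Finset.coe_filter]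
    rfl
  constructor
  · rintro ⟨I, hI, hIk, hdet⟩
    exact ⟨I, (det_submatrix_orderIsoOfFin_ne_zero_iff M I hI).1 hdet,
      by rw [Set.ncard_coe_finset, hI], by rw [hcard, hIk]⟩
  · rintro ⟨I, hIi, hI, hIk⟩
    lift I to Finset (Fin n) using I.toFinite
    rw [Set.ncard_coe_finset] at hI
    rw [hcard] at hIk
    exact ⟨I, hI, hIk, (det_submatrix_orderIsoOfFin_ne_zero_iff M I hI).2 hIi⟩
end

section
/- For every integer k with 1 ≤ k ≤ p−1, let I*_k = {s−p+k} ∪ {s−p+k+2, s−p+k+3, …, s+k−1} ∪ {s+k+1}. Then P_{I*_k}(M) = (−1)^{k(p−k)+1} · (a_{p−k+1} + ξ^{(p−k)}_{k, s−p+k+1} · ξ^{(p−k)}_{k+1, s−p+k}) · ∏_{t=1}^{p−k} a_t^{p−k+1−t}. -/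
open MvPolynomial

/-- The set of variables of the polynomial ring `R`:  `a k` encodes the pivot variable
`a_{k+1}` (`1 ≤ k+1 ≤ p`); `row k t` encodes the variable `ξ^{(k+1)}_{t+1, s+1−(k+1)}`
(with `1 ≤ t+1 ≤ p−(k+1)`); `col k t` encodes the variable `ξ^{(k+1)}_{p+1−(k+1), t+1}`
(with `1 ≤ t+1 ≤ s−(k+1)`).  All indices are encoded 0-based. -/
inductive MCVar (p s : ℕ) : Type
  | a : Fin p → MCVar p s
  | row : (k : Fin p) → Fin (p - (k.1 + 1)) → MCVar p s
  | col : (k : Fin p) → Fin (s - (k.1 + 1)) → MCVar p s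

/-- The polynomial ring `R` over `ℤ` in the variables `a₁, …, a_p`,
`ξ^{(k)}_{t, s+1−k}` (`1 ≤ t ≤ p−k`) and `ξ^{(k)}_{p+1−k, t}` (`1 ≤ t ≤ s−k`). -/
abbrev MCRing (p s : ℕ) : Type := MvPolynomial (MCVar p s) ℤ

/-- The vector `v^{k+1} ∈ R^p`: its `t+1`-st entry equals `ξ^{(k+1)}_{t+1, s+1-(k+1)}` for
`t+1 ≤ p−(k+1)`, equals `1` for `t+1 = p+1−(k+1)`, and `0` afterwards. -/
noncomputable def MCv (p s : ℕ) (k : Fin p) : Fin p → MCRing p s := fun t =>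
  if h : t.1 + 1 ≤ p - (k.1 + 1) then X (MCVar.row k ⟨t.1, by omega⟩)
  else if t.1 + 1 = p - k.1 then 1 else 0

/-- The vector `w^{k+1} ∈ R^s`: its `t+1`-st entry equals `ξ^{(k+1)}_{p+1-(k+1), t+1}` for
`t+1 ≤ s−(k+1)`, equals `1` for `t+1 = s+1−(k+1)`, and `0` afterwards. -/
noncomputable def MCw (p s : ℕ) (k : Fin p) : Fin s → MCRing p s := fun t =>
  if h : t.1 + 1 ≤ s - (k.1 + 1) then X (MCVar.col k ⟨t.1, by omega⟩)
  else if t.1 + 1 = s - k.1 then 1 else 0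

/-- The `p × s` matrix `Z = Σ_{k=1}^p (∏_{t=1}^k a_t) · v^k (w^k)^T`. -/
noncomputable def MCZ (p s : ℕ) : Matrix (Fin p) (Fin s) (MCRing p s) :=
  Matrix.of fun i j =>
    ∑ k : Fin p, (∏ t ∈ Finset.Iic k, X (MCVar.a t)) * MCv p s k i * MCw p s k j

/-- The `p × (s+p)` matrix `M = (Z | I_p)`. -/
noncomputable def MCM (p s : ℕ) : Matrix (Fin p) (Fin (s + p)) (MCRing p s) :=
  Matrix.of fun i j =>
    if h : j.1 < s then MCZ p s i ⟨j.1, h⟩ else if j.1 = s + i.1 then 1 else 0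

/-- The monomial `∏_{t=1}^{p−k} a_t^{p−k+1−t}`. -/
noncomputable def MCmono (p s : ℕ) (k : ℕ) : MCRing p s :=
  ∏ t : Fin p, if t.1 < p - k then X (MCVar.a t) ^ (p - k - t.1) else 1

namespace Matrix

variable {R : Type*} [CommRing R]

/-- If the rank-one sum `∑ i, d i • V i ⊗ W i` is unitriangular except that the last row and
column skip the index `n`, its determinant is that of a diagonal matrix with a corrected last
entry. -/
theorem det_sum_unitriangular_skip {p n : ℕ} (hn : n + 2 ≤ p) (d : Fin p → R)
    (V W : Fin p → Fin (n + 1) → R)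
    (hV : ∀ i x, (if x.1 < n then x.1 else n + 1) < i.1 → V i x = 0)
    (hV' : ∀ i x, i.1 = (if x.1 < n then x.1 else n + 1) → V i x = 1)
    (hW : ∀ i x, (if x.1 < n then x.1 else n + 1) < i.1 → W i x = 0)
    (hW' : ∀ i x, i.1 = (if x.1 < n then x.1 else n + 1) → W i x = 1) :
    (Matrix.of fun x y => ∑ i, d i * V i x * W i y).det =
      (∏ i : Fin n, d ⟨i, by omega⟩) *
        (d ⟨n, by omega⟩ * V ⟨n, by omega⟩ (Fin.last n) * W ⟨n, by omega⟩ (Fin.last n) +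
          d ⟨n + 1, by omega⟩) := by
  obtain ⟨r, rfl⟩ := Nat.exists_eq_add_of_le hn
  set e := d ⟨n, by omega⟩ * V ⟨n, by omega⟩ (Fin.last n) * W ⟨n, by omega⟩ (Fin.last n) +
    d ⟨n + 1, by omega⟩ with he
  let L (V : Fin (n + 2 + r) → Fin (n + 1) → R) : Matrix (Fin (n + 1)) (Fin (n + 1)) R :=
    Matrix.of fun x i => Fin.lastCases (motive := fun _ => R)
      (if x = Fin.last n then 1 else 0) (fun i : Fin n => V ⟨i, by omega⟩ x) i
  let D : Fin (n + 1) → R := Fin.lastCases (motive := fun _ => R) e fun i => d ⟨i, by omega⟩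
  have hL : ∀ V : Fin (n + 2 + r) → Fin (n + 1) → R,
      (∀ i x, (if x.1 < n then x.1 else n + 1) < i.1 → V i x = 0) →
      (∀ i x, i.1 = (if x.1 < n then x.1 else n + 1) → V i x = 1) → (L V).det = 1 := by
    intro V h0 h1
    rw [det_of_isLowerTriangular]
    · refine Finset.prod_eq_one fun x _ => ?_
      induction x using Fin.lastCases with
      | last => simp [L]
      | cast x =>
        simp only [L, of_apply, Fin.lastCases_castSucc]
        exact h1 _ _ (by simp)
    · intro x i hxi
      have hxi : x < i := hxi
      induction i using Fin.lastCases with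
      | last => simp [L, hxi.ne]
      | cast i =>
        simp only [L, of_apply, Fin.lastCases_castSucc]
        have hxi : x.1 < i.1 := hxi
        exact h0 _ _ (by simp only []; split_ifs <;> omega)
  have key : (Matrix.of fun x y => ∑ i, d i * V i x * W i y) =
      L V * diagonal D * (L W)ᵀ := by
    ext x y
    have hz : ∀ j : Fin r, V (Fin.natAdd (n + 2) j) x = 0 := fun j =>
      hV _ _ (by simp only [Fin.val_natAdd]; split_ifs <;> omega)
    rw [of_apply, mul_apply]
    simp only [mul_diagonal, transpose_apply]
    rw [Fin.sum_univ_add, Fin.sum_univ_castSucc, Fin.sum_univ_castSucc, Fin.sum_univ_castSucc]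
    simp only [hz, mul_zero, zero_mul, Finset.sum_const_zero, add_zero, L, D, of_apply,
      Fin.lastCases_castSucc, Fin.lastCases_last]
    rw [add_assoc]
    congr 1
    · exact Finset.sum_congr rfl fun i _ => by
        rw [mul_comm (V _ x)]; rfl
    · change d ⟨n, _⟩ * V ⟨n, _⟩ x * W ⟨n, _⟩ y +
        d ⟨n + 1, _⟩ * V ⟨n + 1, _⟩ x * W ⟨n + 1, _⟩ y = _
      induction x using Fin.lastCases with
      | cast x =>
        rw [hV ⟨n, _⟩ _ (by simp), hV ⟨n + 1, _⟩ _ (by simp)]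
        simp [Fin.castSucc_ne_last]
      | last =>
        induction y using Fin.lastCases with
        | cast y =>
          rw [hW ⟨n, _⟩ _ (by simp), hW ⟨n + 1, _⟩ _ (by simp)]
          simp [Fin.castSucc_ne_last]
        | last =>
          rw [hV' ⟨n + 1, _⟩ _ (by simp), hW' ⟨n + 1, _⟩ _ (by simp)]
          simp [he]
  rw [key, det_mul, det_mul, det_transpose, hL V hV hV', hL W hW hW', det_diagonal,
    Fin.prod_univ_castSucc]
  simp [D]

end Matrix

theorem Fin.prod_prod_Iic_castLE {R : Type*} [CommMonoid R] {p m : ℕ} (hm : m ≤ p)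
    (f : Fin p → R) :
    ∏ i : Fin m, ∏ t ∈ Finset.Iic (⟨i, by omega⟩ : Fin p), f t = ∏ t, f t ^ (m - t.1) := by
  induction m with
  | zero => simp
  | succ m ih =>
    have hI : ∏ t ∈ Finset.Iic (⟨m, by omega⟩ : Fin p), f t =
        ∏ t : Fin p, if t.1 ≤ m then f t else 1 := by
      rw [← Finset.prod_filter]
      exact Finset.prod_congr (by ext t; simp [Fin.le_def]) fun _ _ => rfl
    rw [Fin.prod_univ_castSucc]
    simp only [Fin.val_castSucc, Fin.val_last]
    rw [ih (by omega), hI, ← Finset.prod_mul_distrib]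
    refine Finset.prod_congr rfl fun t _ => ?_
    split_ifs with h
    · rw [← pow_succ, Nat.succ_sub h]
    · rw [mul_one, Nat.sub_eq_zero_of_le (by omega), Nat.sub_eq_zero_of_le (by omega)]

theorem finRotate_pow_val (q j : ℕ) (i : Fin (q + 1)) :
    ((finRotate (q + 1) ^ j) i).1 = (i.1 + j) % (q + 1) := by
  induction j with
  | zero => simp [Nat.mod_eq_of_lt i.2]
  | succ j ih =>
    rw [pow_succ', Equiv.Perm.mul_apply, finRotate_apply, Fin.val_add, ih, Fin.val_one',
      ← Nat.add_mod, add_assoc]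

theorem MCmono_eq (p s k : ℕ) :
    MCmono p s k = ∏ i : Fin (p - k),
      ∏ t ∈ Finset.Iic (⟨i, by omega⟩ : Fin p), (X (MCVar.a t) : MCRing p s) := by
  rw [Fin.prod_prod_Iic_castLE (Nat.sub_le p k), MCmono]
  refine Finset.prod_congr rfl fun t _ => ?_
  split_ifs with h
  · rfl
  · rw [Nat.sub_eq_zero_of_le (by omega), pow_zero]

theorem MCv_eq_zero {p s : ℕ} {k t : Fin p} (h : p < t.1 + k.1 + 1) : MCv p s k t = 0 := by
  rw [MCv, dif_neg (by omega), if_neg (by omega)]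

theorem MCv_eq_one {p s : ℕ} {k t : Fin p} (h : t.1 + k.1 + 1 = p) : MCv p s k t = 1 := by
  rw [MCv, dif_neg (by omega), if_pos (by omega)]

theorem MCw_eq_zero {p s : ℕ} {k : Fin p} {t : Fin s} (h : s < t.1 + k.1 + 1) :
    MCw p s k t = 0 := by
  rw [MCw, dif_neg (by omega), if_neg (by omega)]

theorem MCw_eq_one {p s : ℕ} {k : Fin p} {t : Fin s} (h : t.1 + k.1 + 1 = s) :
    MCw p s k t = 1 := by
  rw [MCw, dif_neg (by omega), if_pos (by omega)]

/-- The minor of `Z` on the last `n + 2` rows and columns with the second of them dropped. -/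
theorem det_MCZ_minor {p s n : ℕ} (hn : n + 2 ≤ p) (hs : p ≤ s)
    (r : Fin (n + 1) → Fin p) (c : Fin (n + 1) → Fin s)
    (hr : ∀ x, (r x).1 = if x.1 = 0 then p - n - 2 else p - n - 1 + x.1)
    (hc : ∀ x, (c x).1 = if x.1 = 0 then s - n - 2 else s - n - 1 + x.1)
    {i₀ i₁ : Fin p} (hi₀ : i₀.1 = n) (hi₁ : i₁.1 = n + 1)
    (t : Fin (p - (i₀.1 + 1))) (ht : t.1 = p - n - 2)
    (u : Fin (s - (i₀.1 + 1))) (hu : u.1 = s - n - 2)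
    {m : ℕ} (hm : m = n + 1) :
    ((MCZ p s).submatrix r c).det =
      (X (MCVar.a i₁) + X (MCVar.row i₀ t) * X (MCVar.col i₀ u)) *
      ∏ i : Fin m, ∏ t ∈ Finset.Iic (⟨i, by omega⟩ : Fin p), (X (MCVar.a t) : MCRing p s) := by
  subst hm
  obtain rfl : i₀ = ⟨n, Nat.lt_of_succ_lt hn⟩ := Fin.ext hi₀
  obtain rfl : i₁ = ⟨n + 1, hn⟩ := Fin.ext hi₁
  obtain rfl : t = ⟨p - n - 2, show _ < p - (n + 1) by clear ht hu t u; omega⟩ := Fin.ext ht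
  obtain rfl : u = ⟨s - n - 2, show _ < s - (n + 1) by clear hu u; omega⟩ := Fin.ext hu
  have hrev : ∀ x : Fin (n + 1), (Fin.rev x).1 = n - x.1 := fun x => by
    rw [Fin.val_rev]; omega
  rw [← Matrix.det_submatrix_equiv_self Fin.revPerm]
  have key := Matrix.det_sum_unitriangular_skip hn
    (fun i => ∏ t ∈ Finset.Iic i, (X (MCVar.a t) : MCRing p s))
    (fun i x => MCv p s i (r (Fin.rev x))) (fun i x => MCw p s i (c (Fin.rev x)))
    (fun i x h => MCv_eq_zero (by
      have := hr (Fin.rev x); rw [hrev] at this; split_ifs at h this <;> omega))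
    (fun i x h => MCv_eq_one (by
      have := hr (Fin.rev x); rw [hrev] at this; split_ifs at h this <;> omega))
    (fun i x h => MCw_eq_zero (by
      have := hc (Fin.rev x); rw [hrev] at this; split_ifs at h this <;> omega))
    (fun i x h => MCw_eq_one (by
      have := hc (Fin.rev x); rw [hrev] at this; split_ifs at h this <;> omega))
  refine key.trans ?_
  have hr0 : r (Fin.rev (Fin.last n)) = ⟨p - n - 2, by omega⟩ :=
    Fin.ext (by rw [hr]; simp)
  have hc0 : c (Fin.rev (Fin.last n)) = ⟨s - n - 2, by omega⟩ :=
    Fin.ext (by rw [hc]; simp)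
  have hv : MCv p s ⟨n, by omega⟩ ⟨p - n - 2, by omega⟩ =
      X (MCVar.row ⟨n, by omega⟩ ⟨p - n - 2, show _ < p - (n + 1) by omega⟩) := by
    rw [MCv, dif_pos (by simp only []; omega)]
  have hw : MCw p s ⟨n, by omega⟩ ⟨s - n - 2, by omega⟩ =
      X (MCVar.col ⟨n, by omega⟩ ⟨s - n - 2, show _ < s - (n + 1) by omega⟩) := by
    rw [MCw, dif_pos (by simp only []; omega)]
  have hI : Finset.Iic (⟨n + 1, by omega⟩ : Fin p) =
      insert ⟨n + 1, by omega⟩ (Finset.Iic ⟨n, by omega⟩) := by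
    ext t
    simp only [Finset.mem_Iic, Finset.mem_insert, Fin.le_def, Fin.ext_iff]
    omega
  rw [hr0, hc0, hv, hw, hI, Finset.prod_insert (by simp [Fin.le_def]), Fin.prod_univ_castSucc]
  simp only [Fin.val_castSucc, Fin.val_last]
  ring

/-- from the proof of Lemma 3.2.  For `1 ≤ k ≤ p−1`, let
`I*_k = {s−p+k} ∪ {s−p+k+2, …, s+k−1} ∪ {s+k+1}` (1-indexed; its increasing enumeration,
0-indexed, sends `j = 0` to `s−p+k−1`, `1 ≤ j ≤ p−2` to `s−p+k+j`, and `j = p−1` to `s+k`).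
Then `P_{I*_k}(M) = (−1)^{k(p−k)+1} · (a_{p−k+1} + ξ^{(p−k)}_{k, s−p+k+1} ·
ξ^{(p−k)}_{k+1, s−p+k}) · ∏_{t=1}^{p−k} a_t^{p−k+1−t}`. -/
theorem plucker_of_Ik_star
    (p s : ℕ) (hp : 1 ≤ p) (hs : p ≤ s) (k : ℕ) (hk1 : 1 ≤ k) (hk2 : k ≤ p - 1) :
    (Matrix.submatrix (MCM p s) id
        (fun j : Fin p =>
          if _ : j.1 = 0 then (⟨s - p + k - 1, by omega⟩ : Fin (s + p))
          else if _ : j.1 = p - 1 then ⟨s + k, by omega⟩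
          else ⟨s - p + k + j.1, by have := j.2; omega⟩)).det =
      (-1) ^ (k * (p - k) + 1) *
        (MvPolynomial.X (MCVar.a (⟨p - k, by omega⟩ : Fin p)) +
          MvPolynomial.X (MCVar.row (⟨p - k - 1, by omega⟩ : Fin p)
            ⟨k - 1, show k - 1 < p - (p - k - 1 + 1) by omega⟩) *
          MvPolynomial.X (MCVar.col (⟨p - k - 1, by omega⟩ : Fin p)
            ⟨s - p + k - 1, show s - p + k - 1 < s - (p - k - 1 + 1) by omega⟩)) *
        MCmono p s k := by
  obtain ⟨q, rfl⟩ : ∃ q, p = q + 1 := ⟨p - 1, by omega⟩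
  obtain ⟨n, hn⟩ : ∃ n, q + 1 - k = n + 1 := ⟨q - k, by omega⟩
  set c : Fin (q + 1) → Fin (s + (q + 1)) := fun j =>
    if _ : j.1 = 0 then ⟨s - (q + 1) + k - 1, by omega⟩
    else if _ : j.1 = q + 1 - 1 then ⟨s + k, by omega⟩
    else ⟨s - (q + 1) + k + j.1, by have := j.2; omega⟩ with hc_def
  have hc : ∀ j, (c j).1 = if j.1 = 0 then s - (q + 1) + k - 1
      else if j.1 = q then s + k else s - (q + 1) + k + j.1 := fun j => by
    simp only [hc_def, Nat.add_sub_cancel]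
    split_ifs <;> rfl
  let σ : Equiv.Perm (Fin (q + 1)) :=
    Equiv.swap ⟨k - 1, by omega⟩ ⟨k, by omega⟩ * finRotate (q + 1) ^ k
  have hσ : ∀ j, (σ j).1 = if j.1 = 0 then k - 1 else if j.1 = q then k
      else if j.1 < n + 1 then k + j.1 else j.1 - (n + 1) := fun j => by
    have h := finRotate_pow_val q k j
    have hmod : (j.1 + k) % (q + 1) = if j.1 < n + 1 then k + j.1 else j.1 - (n + 1) := by
      split_ifs with hj
      · rw [Nat.mod_eq_of_lt (by omega), add_comm]
      · rw [Nat.mod_eq_sub_mod (by omega), Nat.mod_eq_of_lt (by omega)]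
        omega
    rw [hmod] at h
    have := j.2
    simp only [σ, Equiv.Perm.mul_apply, Equiv.swap_apply_def, Fin.ext_iff, apply_ite Fin.val]
    by_cases hj : j.1 < n + 1
    · rw [if_pos hj] at h
      rw [h, if_pos hj]
      split_ifs <;> omega
    · rw [if_neg hj] at h
      rw [h, if_neg hj]
      split_ifs <;> omega
  have hsign : ((Equiv.Perm.sign σ : ℤˣ) : MCRing (q + 1) s) =
      (-1) ^ (k * (q + 1 - k) + 1) := by
    have hpar : (-1 : ℤˣ) ^ (q * k) = (-1) ^ (k * (q + 1 - k)) := by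
      obtain ⟨l, rfl⟩ : ∃ l, k = l + 1 := ⟨k - 1, by omega⟩
      obtain ⟨r, rfl⟩ : ∃ r, q = l + 1 + r := ⟨q - (l + 1), by omega⟩
      have h1 : (l + 1 + r) * (l + 1) = (l + 1) * (l + 1 + r + 1 - (l + 1)) + l * (l + 1) := by
        rw [show l + 1 + r + 1 - (l + 1) = r + 1 by omega]; ring
      rw [h1, pow_add, (Nat.even_mul_succ_self l).neg_one_pow, mul_one]
    have h : Equiv.Perm.sign σ = (-1 : ℤˣ) ^ (k * (q + 1 - k) + 1) := by
      simp only [σ, Equiv.Perm.sign_mul, map_pow, sign_finRotate]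
      rw [Equiv.Perm.sign_swap (by simp [Fin.ext_iff]; omega), ← pow_mul, Nat.add_sub_cancel, hpar,
        pow_succ']
    rw [h]; push_cast; rfl
  have hσc : (((MCM (q + 1) s).submatrix id c).submatrix σ id).det =
      (X (MCVar.a ⟨q + 1 - k, by omega⟩) +
        X (MCVar.row ⟨q + 1 - k - 1, by omega⟩
          ⟨k - 1, show k - 1 < q + 1 - (q + 1 - k - 1 + 1) by omega⟩) *
        X (MCVar.col ⟨q + 1 - k - 1, by omega⟩
          ⟨s - (q + 1) + k - 1, show _ < s - (q + 1 - k - 1 + 1) by omega⟩)) *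
      MCmono (q + 1) s k := by
    let e : Fin (n + 1) ⊕ Fin k ≃ Fin (q + 1) :=
      finSumFinEquiv.trans (finCongr (by omega))
    have hel : ∀ x, (e (.inl x)).1 = x.1 := fun x => by simp [e]
    have her : ∀ x, (e (.inr x)).1 = n + 1 + x.1 := fun x => by simp [e]
    have hcl : ∀ x, (c (e (.inl x))).1 < s := fun x => by
      rw [hc, hel]; split_ifs <;> omega
    have hblock : (((MCM (q + 1) s).submatrix id c).submatrix σ id).submatrix e e =
        Matrix.fromBlocks
          ((MCZ (q + 1) s).submatrix (fun x => σ (e (.inl x))) fun x => ⟨_, hcl x⟩) 0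
          (Matrix.of fun x y => MCM (q + 1) s (σ (e (.inr x))) (c (e (.inl y)))) 1 := by
      have hcr : ∀ y, (c (e (.inr y))).1 = if n + 1 + y.1 = q then s + k else s + y.1 :=
        fun y => by rw [hc, her]; split_ifs <;> omega
      refine Matrix.ext fun x y => ?_
      rcases x with x | x <;> rcases y with y | y
      · simp [MCM, hcl]
      · have h1 := hσ (e (.inl x))
        have h2 := hcr y
        rw [hel] at h1
        simp only [Matrix.submatrix_apply, id, MCM, Matrix.of_apply, Matrix.fromBlocks_apply₁₂,
          Matrix.zero_apply]
        rw [dif_neg (by split_ifs at h2 <;> omega), if_neg (by split_ifs at h1 h2 <;> omega)]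
      · rfl
      · have h1 := hσ (e (.inr x))
        have h2 := hcr y
        rw [her] at h1
        simp only [Matrix.submatrix_apply, id, MCM, Matrix.of_apply, Matrix.fromBlocks_apply₂₂,
          Matrix.one_apply, Fin.ext_iff]
        rw [dif_neg (by split_ifs at h2 <;> omega)]
        have hxy : (c (e (.inr y))).1 = s + (σ (e (.inr x))).1 ↔ x.1 = y.1 := by
          rw [h1, h2]; split_ifs <;> omega
        exact if_congr hxy rfl rfl
    rw [← Matrix.det_submatrix_equiv_self e, hblock, Matrix.det_fromBlocks_zero₁₂,
      Matrix.det_one, mul_one, MCmono_eq]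
    refine det_MCZ_minor (n := n) (by omega) hs _ _ (fun x => ?_) (fun x => ?_)
      (by simp only []; omega) (by simp only []; omega) _ (by simp only []; omega) _
      (by simp only []; omega) hn
    · rw [hσ, hel]; split_ifs <;> omega
    · simp only [hc, hel]; split_ifs <;> omega
  rw [Matrix.det_permute, hsign] at hσc
  rw [mul_assoc, ← hσc, ← mul_assoc, ← pow_add, (Even.add_self _).neg_one_pow, one_mul]
end
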